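/- Let A be a live weakly-hierarchical visibly pushdown automaton. A symmetric assignment v : Q × Q → Bool satisfies the hard constraints of the RAQ encoding if and only if the induced relation R_v = {(p, q) : v(p, q) = true} is a reachability-aware quotienting (RAQ) relation for A. -/

import Mathlib

/-- The kind of a symbol in a visibly pushdown alphabet:
internal, call, or return. -/
inductive SymKind : Type
  | int | call | ret
deriving DecidableEq

/-- A weakly-hierarchical visibly pushdown automaton over states `Q` and
alphabet `S`.  The partition of the alphabet is given by `kind`; the
bottom-of-stack symbol is implicit (stacks are lists of states, the empty
list playing the role of `⊥`, and the head of the list being the topmost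
symbol). -/
structure VPA (Q : Type) (S : Type) where
  kind : S → SymKind
  δi : Q → S → Q → Prop
  δc : Q → S → Q → Prop
  δr : Q → S → Q → Q → Prop
  Q0 : Set Q
  F : Set Q
  Q0_nonempty : Q0.Nonempty
  δi_kind : ∀ p a q, δi p a q → kind a = SymKind.int
  δc_kind : ∀ p c q, δc p c q → kind c = SymKind.call
  δr_kind : ∀ p r qh q, δr p r qh q → kind r = SymKind.ret

namespace VPA

variable {Q S : Type}

/-- A configuration: current state together with the stack
(head = topmost symbol; `[]` = the empty stack `⊥`). -/
abbrev Config (Q : Type) := Q × List Q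

/-- One step of the automaton on a symbol. Internal symbols leave the stack
unchanged, call symbols push the current state, return symbols pop the
matching topmost stack symbol. -/
def Step (A : VPA Q S) (c : Config Q) (s : S) (c' : Config Q) : Prop :=
  match A.kind s with
  | SymKind.int  => A.δi c.1 s c'.1 ∧ c'.2 = c.2
  | SymKind.call => A.δc c.1 s c'.1 ∧ c'.2 = c.1 :: c.2
  | SymKind.ret  => ∃ qh, A.δr c.1 s qh c'.1 ∧ c.2 = qh :: c'.2

/-- `ρ` is a run of `A` on the word `w`. -/
def IsRunOn (A : VPA Q S) (w : List S) (ρ : Fin (w.length + 1) → Config Q) : Prop :=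
  ∀ i : Fin w.length, A.Step (ρ i.castSucc) (w.get i) (ρ i.succ)

/-- A run is initial if it starts in an initial state with the empty stack `⊥`. -/
def IsInitial (A : VPA Q S) {n : ℕ} (ρ : Fin (n + 1) → Config Q) : Prop :=
  (ρ 0).1 ∈ A.Q0 ∧ (ρ 0).2 = []

/-- `A` accepts `w` if some initial run of `A` on `w` ends in an accepting state. -/
def Accepts (A : VPA Q S) (w : List S) : Prop :=
  ∃ ρ : Fin (w.length + 1) → Config Q,
    A.IsRunOn w ρ ∧ A.IsInitial ρ ∧ (ρ (Fin.last w.length)).1 ∈ A.F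

/-- The language of `A`. -/
def lang (A : VPA Q S) : Set (List S) := {w | A.Accepts w}

/-- A configuration is reachable if it occurs in some initial run of `A`. -/
def Reachable (A : VPA Q S) (c : Config Q) : Prop :=
  ∃ (w : List S) (ρ : Fin (w.length + 1) → Config Q),
    A.IsRunOn w ρ ∧ A.IsInitial ρ ∧ ∃ i, ρ i = c

/-- `tops A q` = set of topmost stack symbols of reachable stacks for `q`
(`none` plays the role of the bottom-of-stack symbol `⊥`). -/
def tops (A : VPA Q S) (q : Q) : Set (Option Q) :=
  {t | ∃ σ : List Q, A.Reachable (q, σ) ∧ σ.head? = t}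

/-- `A` is live: every state has outgoing transitions for every internal and
call symbol, and has an outgoing return transition for return symbol `s` and
stack symbol `qh` if and only if `qh` is the topmost symbol of some
reachable stack. -/
def Live (A : VPA Q S) : Prop :=
  (∀ q s, A.kind s = SymKind.int → ∃ q', A.δi q s q') ∧
  (∀ q s, A.kind s = SymKind.call → ∃ q', A.δc q s q') ∧
  (∀ q s qh, A.kind s = SymKind.ret →
    ((∃ q', A.δr q s qh q') ↔ some qh ∈ A.tops q))

/-- `R` is a reachability-aware quotienting (RAQ) relation for `A`. -/
def IsRAQ (A : VPA Q S) (R : Q → Q → Prop) : Prop :=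
  Equivalence R ∧
  ∀ p q, R p q →
    (p ∈ A.F ↔ q ∈ A.F) ∧
    (∀ a p', A.δi p a p' → ∃ q', A.δi q a q' ∧ R p' q') ∧
    (∀ a q', A.δi q a q' → ∃ p', A.δi p a p' ∧ R p' q') ∧
    (∀ c p', A.δc p c p' → ∃ q', A.δc q c q' ∧ R p' q') ∧
    (∀ c q', A.δc q c q' → ∃ p', A.δc p c p' ∧ R p' q') ∧
    (∀ ph qh, R ph qh →
      ((∀ r p', A.δr p r ph p' → ∃ q', A.δr q r qh q' ∧ R p' q') ∧
       (∀ r q', A.δr q r qh q' → ∃ p', A.δr p r ph p' ∧ R p' q'))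
      ∨ some qh ∉ A.tops q ∨ some ph ∉ A.tops p)

/-- The quotient VPA `A/R` for an equivalence relation (setoid) `R` on states. -/
def quot (A : VPA Q S) (R : Setoid Q) : VPA (Quotient R) S where
  kind := A.kind
  δi := fun P a P' => ∃ p p', A.δi p a p' ∧
    Quotient.mk R p = P ∧ Quotient.mk R p' = P'
  δc := fun P c P' => ∃ p p', A.δc p c p' ∧
    Quotient.mk R p = P ∧ Quotient.mk R p' = P'
  δr := fun P r Ph P' => ∃ p ph p', A.δr p r ph p' ∧
    Quotient.mk R p = P ∧ Quotient.mk R ph = Ph ∧ Quotient.mk R p' = P'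
  Q0 := {P | ∃ q ∈ A.Q0, Quotient.mk R q = P}
  F := {P | ∃ q ∈ A.F, Quotient.mk R q = P}
  Q0_nonempty := by
    obtain ⟨q, hq⟩ := A.Q0_nonempty
    exact ⟨Quotient.mk R q, q, hq, rfl⟩
  δi_kind := by rintro P a P' ⟨p, p', h, -, -⟩; exact A.δi_kind p a p' h
  δc_kind := by rintro P c P' ⟨p, p', h, -, -⟩; exact A.δc_kind p c p' h
  δr_kind := by rintro P r Ph P' ⟨p, ph, p', h, -, -, -⟩; exact A.δr_kind p r ph p' h

end VPA

/-- A word is matched-return if every prefix ending in a return symbol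
has strictly more call symbols than return symbols before that return. -/
def MR {S : Type} (kind : S → SymKind) (w : List S) : Prop :=
  ∀ v r, (v ++ [r]) <+: w → kind r = SymKind.ret →
    v.countP (fun s => decide (kind s = SymKind.call)) >
      v.countP (fun s => decide (kind s = SymKind.ret))

/-- A symmetric Boolean assignment `v` on pairs of states satisfies the hard
constraints of the RAQ PMax-SAT encoding. -/
def HardSat {Q S : Type} (A : VPA Q S) (v : Q → Q → Bool) : Prop :=
  (∀ q, v q q = true) ∧
  (∀ q1 q2 q3, v q1 q2 = true → v q2 q3 = true → v q1 q3 = true) ∧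
  (∀ p q, Xor' (p ∈ A.F) (q ∈ A.F) → v p q = false) ∧
  (∀ p a p' q, A.δi p a p' → v p q = true →
    ∃ q', A.δi q a q' ∧ v p' q' = true) ∧
  (∀ p c p' q, A.δc p c p' → v p q = true →
    ∃ q', A.δc q c q' ∧ v p' q' = true) ∧
  (∀ p r ph p' q qh, A.δr p r ph p' → some ph ∈ A.tops p → some qh ∈ A.tops q →
    v p q = true → v ph qh = true →
    ∃ q', A.δr q r qh q' ∧ v p' q' = true)

/-- A symmetric assignment satisfies the hard constraints of the RAQ encoding
iff the induced relation is a RAQ relation. -/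
theorem hardSat_iff_isRAQ {Q S : Type} [Fintype Q] [Fintype S]
    (A : VPA Q S) (hlive : A.Live)
    (v : Q → Q → Bool) (hsym : ∀ p q, v p q = v q p) :
    HardSat A v ↔ A.IsRAQ (fun p q => v p q = true) := by
  constructor
  · rintro ⟨hrefl, htrans, hfin, hint, hcall, hret⟩
    have symm {p q : Q} (h : v p q = true) : v q p = true := hsym p q ▸ h
    refine ⟨⟨hrefl, symm, fun h₁ h₂ => htrans _ _ _ h₁ h₂⟩, fun p q hpq => ⟨?_, ?_, ?_, ?_, ?_, ?_⟩⟩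
    · by_contra hne
      have hf := hfin p q (xor_iff_not_iff _ _ |>.mpr hne)
      simp [hf] at hpq
    · exact fun a p' h => hint p a p' q h hpq
    · intro a q' h
      obtain ⟨p', hp', hv⟩ := hint q a q' p h (symm hpq)
      exact ⟨p', hp', symm hv⟩
    · exact fun c p' h => hcall p c p' q h hpq
    · intro c q' h
      obtain ⟨p', hp', hv⟩ := hcall q c q' p h (symm hpq)
      exact ⟨p', hp', symm hv⟩
    · intro ph qh hh
      by_cases hq : some qh ∈ A.tops q
      · by_cases hp : some ph ∈ A.tops p
        · refine Or.inl ⟨fun r p' h => hret p r ph p' q qh h hp hq hpq hh, fun r q' h => ?_⟩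
          obtain ⟨p', hp', hv⟩ := hret q r qh q' p ph h hq hp (symm hpq) (symm hh)
          exact ⟨p', hp', symm hv⟩
        · exact Or.inr (Or.inr hp)
      · exact Or.inr (Or.inl hq)
  · rintro ⟨heq, h⟩
    refine ⟨heq.refl, fun _ _ _ => heq.trans, fun p q hx => ?_, fun p a p' q ht hpq => ?_,
      fun p c p' q ht hpq => ?_, fun p r ph p' q qh ht hp hq hpq hh => ?_⟩
    · by_contra hne
      exact (xor_iff_not_iff _ _).mp hx (h p q (by simpa using hne)).1
    · exact (h p q hpq).2.1 a p' ht
    · exact (h p q hpq).2.2.2.1 c p' ht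
    · rcases (h p q hpq).2.2.2.2.2 ph qh hh with hr | hr | hr
      · exact hr.1 r p' ht
      · exact absurd hq hr
      · exact absurd hp hr
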